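/- Let (X,ρ,μ) be a space of homogeneous type with quasi-triangle constant K₀ and doubling constant L. Let φ : X × (0,∞) → (0,∞) satisfy the doubling condition (there is C ≥ 1 with C⁻¹ ≤ φ(x,r)/φ(x,s) ≤ C whenever r/s ∈ [1/2,2]) and the integral condition ∫_r^∞ φ(x,t)/t dt ≤ C_φ·φ(x,r) for all x ∈ X and r > 0, and let Φ be a strictly increasing Orlicz function of positive lower type and finite positive upper type. Then there exist θ ∈ (0,1) and C ∈ [1,∞), depending only on K₀, L, Φ, and φ, such that for every measurable f on X: ‖f‖_{L^{(Φ,φ)}(X)} ≤ sup_B ‖f‖_{L^Φ_{(M𝟏_B)^{1−θ}}(X, μ_B)} ≤ C·‖f‖_{L^{(Φ,φ)}(X)}, where the supremum is over all balls B ⊆ X, μ_B := μ/(φ(B)·μ(B)), and ‖g‖_{L^Φ_w(X,ν)} := inf{λ > 0 : ∫_X Φ(|g|/λ)·w dν ≤ 1}. -/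

import Mathlib

noncomputable section

open MeasureTheory Filter Set
open scoped ENNReal NNReal Topology

namespace Paper

variable {X : Type*} [MeasurableSpace X]

/-- The ball with center `x` and radius `r` for the quasi-metric `ρ`. -/
def ball (ρ : X → X → ℝ) (x : X) (r : ℝ) : Set X := {y | ρ x y < r}

/-- `(X, ρ, μ)` is a quasi-metric measure space with quasi-triangle constant `K₀`:
`ρ` is a quasi-metric with constant `K₀` and all `ρ`-balls are `μ`-measurable. -/
structure IsQuasiMetricMeasure (ρ : X → X → ℝ) (μ : Measure X) (K₀ : ℝ) : Prop where
  nonneg : ∀ x y, 0 ≤ ρ x y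
  eq_zero_iff : ∀ x y, ρ x y = 0 ↔ x = y
  symm : ∀ x y, ρ x y = ρ y x
  one_le : 1 ≤ K₀
  triangle : ∀ x y z, ρ x z ≤ K₀ * (ρ x y + ρ y z)
  measurableSet_ball : ∀ x r, MeasurableSet (ball ρ x r)

/-- The doubling condition for `μ` with doubling constant `L ∈ [1, ∞)`. -/
def IsDoubling (ρ : X → X → ℝ) (μ : Measure X) (L : ℝ≥0∞) : Prop :=
  1 ≤ L ∧ L < ∞ ∧ ∀ (x : X) (r : ℝ), 0 < r →
    0 < μ (ball ρ x r) ∧ μ (ball ρ x (2 * r)) ≤ L * μ (ball ρ x r) ∧ μ (ball ρ x r) < ∞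

/-- `Φ` is an Orlicz function (conditions imposed on `[0,∞)`). -/
structure OrliczFun (Φ : ℝ → ℝ) : Prop where
  zero : Φ 0 = 0
  nonneg : ∀ t, 0 ≤ t → 0 ≤ Φ t
  mono : ∀ s t, 0 ≤ s → s ≤ t → Φ s ≤ Φ t
  pos : ∀ t, 0 < t → 0 < Φ t
  tendsto_atTop : Tendsto Φ atTop atTop

/-- `Φ` is of lower type `r`. -/
def LowerType (Φ : ℝ → ℝ) (r : ℝ) : Prop :=
  ∃ C : ℝ, 1 ≤ C ∧ ∀ t s : ℝ, 0 < t → 0 < s → s < 1 → Φ (s * t) ≤ C * s ^ r * Φ t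

/-- `Φ` is of upper type `r`. -/
def UpperType (Φ : ℝ → ℝ) (r : ℝ) : Prop :=
  ∃ C : ℝ, 1 ≤ C ∧ ∀ t s : ℝ, 0 < t → 1 < s → Φ (s * t) ≤ C * s ^ r * Φ t

/-- The canonical extension of `Φ` to `ℝ≥0∞`. -/
def extO (Φ : ℝ → ℝ) (t : ℝ≥0∞) : ℝ≥0∞ :=
  if t = ∞ then ∞ else ENNReal.ofReal (Φ t.toReal)

/-- The generalized inverse of `Φ`. -/
def invO (Φ : ℝ → ℝ) (u : ℝ) : ℝ :=
  sInf {t : ℝ | 0 ≤ t ∧ u ≤ Φ t}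

/-- `‖f‖_{Φ,φ,B}` for the ball `B = B(x,r)`:
the least `λ` with `μ(B)⁻¹ ∫_B Φ(|f|/λ) dμ ≤ φ(B)`. -/
def ballNorm (ρ : X → X → ℝ) (μ : Measure X) (Φ : ℝ → ℝ) (φ : X → ℝ → ℝ)
    (x : X) (r : ℝ) (g : X → ℝ≥0∞) : ℝ≥0∞ :=
  sInf {lam : ℝ≥0∞ | lam ≠ 0 ∧
    (∫⁻ y in ball ρ x r, extO Φ (g y / lam) ∂μ) ≤
      ENNReal.ofReal (φ x r) * μ (ball ρ x r)}

/-- The generalized Orlicz–Morrey quasi-norm `‖f‖_{L^{(Φ,φ)}(X)}`. -/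
def OMnorm (ρ : X → X → ℝ) (μ : Measure X) (Φ : ℝ → ℝ) (φ : X → ℝ → ℝ)
    (g : X → ℝ≥0∞) : ℝ≥0∞ :=
  ⨆ (x : X) (r : ℝ) (_ : 0 < r), ballNorm ρ μ Φ φ x r g

/-- `φ` takes values in `(0,∞)`. -/
def PhiPos (φ : X → ℝ → ℝ) : Prop := ∀ (x : X) (r : ℝ), 0 < r → 0 < φ x r

/-- The nearness condition for `φ`. -/
def Nearness (ρ : X → X → ℝ) (φ : X → ℝ → ℝ) : Prop :=
  ∃ C : ℝ, 1 ≤ C ∧ ∀ (x y : X) (r : ℝ), 0 < r → ρ x y ≤ r → φ x r ≤ C * φ y r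

/-- `φ ∈ 𝒢^dec_1`: `r ↦ μ(B(x,r))φ(x,r)` is almost increasing and
`r ↦ φ(x,r)` is almost decreasing. -/
def Gdec1 (ρ : X → X → ℝ) (μ : Measure X) (φ : X → ℝ → ℝ) : Prop :=
  ∃ C : ℝ, 1 ≤ C ∧ ∀ (x : X) (r s : ℝ), 0 < r → r ≤ s →
    μ (ball ρ x r) * ENNReal.ofReal (φ x r) ≤
        ENNReal.ofReal C * (μ (ball ρ x s) * ENNReal.ofReal (φ x s)) ∧
      φ x s ≤ C * φ x r

/-- The Hardy–Littlewood maximal operator on `(X, ρ, μ)`. -/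
def maximal (ρ : X → X → ℝ) (μ : Measure X) (g : X → ℝ≥0∞) (x : X) : ℝ≥0∞ :=
  ⨆ (z : X) (r : ℝ) (_ : 0 < r) (_ : x ∈ ball ρ z r),
    (∫⁻ y in ball ρ z r, g y ∂μ) / μ (ball ρ z r)

/-- The weighted Orlicz norm of `g` with respect to a measure `ν` and weight `w`. -/
def wOrliczNorm (Φ : ℝ → ℝ) (ν : Measure X) (w : X → ℝ≥0∞) (g : X → ℝ≥0∞) :
    ℝ≥0∞ :=
  sInf {lam : ℝ≥0∞ | lam ≠ 0 ∧ (∫⁻ x, extO Φ (g x / lam) * w x ∂ν) ≤ 1}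

/-- The doubling condition for `φ`. -/
def PhiDoubling (φ : X → ℝ → ℝ) : Prop :=
  ∃ C : ℝ, 1 ≤ C ∧ ∀ (x : X) (r s : ℝ), 0 < r → 0 < s → r ≤ 2 * s → s ≤ 2 * r →
    φ x r ≤ C * φ x s

/-- The integral condition `∫_r^∞ φ(x,t)/t dt ≤ C_φ φ(x,r)`. -/
def PhiIntCond (φ : X → ℝ → ℝ) (Cφ : ℝ) : Prop :=
  ∀ (x : X) (r : ℝ), 0 < r →
    IntegrableOn (fun t => φ x t / t) (Set.Ioi r) volume ∧
    (∫ t in Set.Ioi r, φ x t / t) ≤ Cφ * φ x r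

lemma maximal_le_one (ρ : X → X → ℝ) (μ : Measure X) (s : Set X) (y : X) :
    maximal ρ μ (s.indicator fun _ => 1) y ≤ 1 := by
  unfold maximal
  refine iSup_le fun z => iSup_le fun r => iSup_le fun hr => iSup_le fun hy => ?_
  refine ENNReal.div_le_of_le_mul ?_
  rw [one_mul]
  calc _ ≤ ∫⁻ y in ball ρ z r, 1 ∂μ :=
        lintegral_mono fun a => Set.indicator_le_self' (fun _ _ => by simp) a
    _ = _ := by simp

lemma one_le_maximal (ρ : X → X → ℝ) (μ : Measure X) (x : X) (r : ℝ) (hr : 0 < r)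
    (hm : MeasurableSet (ball ρ x r)) (h0 : μ (ball ρ x r) ≠ 0) (h1 : μ (ball ρ x r) ≠ ∞)
    (y : X) (hy : y ∈ ball ρ x r) :
    1 ≤ maximal ρ μ ((ball ρ x r).indicator fun _ => 1) y := by
  unfold maximal
  refine le_iSup_of_le x (le_iSup_of_le r (le_iSup_of_le hr (le_iSup_of_le hy ?_)))
  rw [lintegral_indicator_const hm, Measure.restrict_apply_self, one_mul,
    ENNReal.div_self h0 h1]

lemma doubling_iter {ρ : X → X → ℝ} {μ : Measure X} {L : ℝ≥0∞} (hL : IsDoubling ρ μ L)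
    (x : X) (r : ℝ) (hr : 0 < r) (n : ℕ) :
    μ (ball ρ x (2 ^ n * r)) ≤ L ^ n * μ (ball ρ x r) := by
  induction n with
  | zero => simp
  | succ n ih =>
    have := (hL.2.2 x (2 ^ n * r) (by positivity)).2.1
    rw [show (2:ℝ) ^ (n+1) * r = 2 * (2 ^ n * r) by ring]
    refine this.trans ?_
    rw [pow_succ', mul_assoc]
    gcongr

lemma ball_mono (ρ : X → X → ℝ) (x : X) {r s : ℝ} (h : r ≤ s) : ball ρ x r ⊆ ball ρ x s :=
  fun _ hy => lt_of_lt_of_le hy h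

lemma maximal_decay {ρ : X → X → ℝ} {μ : Measure X} {K₀ : ℝ} {L : ℝ≥0∞}
    (hX : IsQuasiMetricMeasure ρ μ K₀) (hL : IsDoubling ρ μ L) (m : ℕ)
    (hm : 9 * K₀ ^ 4 ≤ 2 ^ m) (x : X) (r R : ℝ) (hr : 0 < r) (hR : r ≤ R) (y : X)
    (hy : y ∉ ball ρ x R) :
    maximal ρ μ ((ball ρ x r).indicator fun _ => 1) y * μ (ball ρ x R)
      ≤ L ^ m * μ (ball ρ x r) := by
  have hK := hX.one_le
  have hK2 : K₀ ≤ K₀ ^ 4 := le_self_pow₀ hK (by norm_num)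
  rcases lt_or_ge R (2 * K₀ * r) with h | h
  · calc _ ≤ 1 * μ (ball ρ x R) := by gcongr; exact maximal_le_one _ _ _ _
      _ = μ (ball ρ x R) := one_mul _
      _ ≤ μ (ball ρ x (2 ^ m * r)) := by
        refine measure_mono (ball_mono ρ x ?_)
        nlinarith
      _ ≤ _ := doubling_iter hL x r hr m
  have hb0 := (hL.2.2 x R (by linarith)).1.ne'
  have hb1 := (hL.2.2 x R (by linarith)).2.2.ne
  rw [← ENNReal.le_div_iff_mul_le (Or.inl hb0) (Or.inl hb1)]
  unfold maximal
  refine iSup_le fun z => iSup_le fun s => iSup_le fun hs => iSup_le fun hyz => ?_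
  rw [ENNReal.le_div_iff_mul_le (Or.inl hb0) (Or.inl hb1)]
  rw [lintegral_indicator_const (hX.measurableSet_ball x r), one_mul,
    Measure.restrict_apply (hX.measurableSet_ball x r)]
  by_cases hne : (ball ρ x r ∩ ball ρ z s).Nonempty
  swap
  · rw [Set.not_nonempty_iff_eq_empty.1 hne]; simp
  obtain ⟨p, hpx, hpz⟩ := hne
  simp only [ball, mem_setOf_eq, not_lt] at hpx hpz hy hyz
  have h1 := hX.triangle x p y
  have h2 := hX.triangle p z y
  rw [hX.symm p z] at h2
  have hsR : R ≤ 4 * K₀ ^ 2 * s := by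
    have : K₀ * ρ p y ≤ K₀ * (K₀ * (2 * s)) := by
      gcongr; refine h2.trans ?_; gcongr; linarith
    have : K₀ * ρ x p ≤ K₀ * r := by gcongr
    nlinarith
  have hsub : ball ρ x R ⊆ ball ρ z (2 ^ m * s) := by
    intro w hw
    simp only [ball, mem_setOf_eq] at hw ⊢
    have h3 := hX.triangle z p w
    have h4 := hX.triangle p x w
    rw [hX.symm p x] at h4
    have h5 : ρ p w ≤ K₀ * (2 * R) := by
      refine h4.trans ?_; gcongr; linarith
    have h6 : ρ z w < K₀ * (s + K₀ * (2 * R)) := by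
      refine h3.trans_lt ?_
      have : 0 < K₀ := by linarith
      exact mul_lt_mul_of_pos_left (by linarith) this
    have h7 : K₀ ^ 2 * R ≤ K₀ ^ 2 * (4 * K₀ ^ 2 * s) := by gcongr
    have h8 : K₀ * s ≤ K₀ ^ 4 * s := by gcongr
    have h9 : 9 * K₀ ^ 4 * s ≤ 2 ^ m * s := by gcongr
    nlinarith
  have hz0 := (hL.2.2 z s hs).1.ne'
  have hz1 := (hL.2.2 z s hs).2.2.ne
  calc _ ≤ μ (ball ρ x r) / μ (ball ρ z s) * (L ^ m * μ (ball ρ z s)) := by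
        gcongr
        · exact Set.inter_subset_left
        · exact (measure_mono hsub).trans (doubling_iter hL z s hs m)
    _ = L ^ m * (μ (ball ρ x r) / μ (ball ρ z s) * μ (ball ρ z s)) := by ring
    _ = _ := by rw [ENNReal.div_mul_cancel hz0 hz1]

lemma phi_decay {φ : X → ℝ → ℝ} (hφpos : PhiPos φ) (hφD : PhiDoubling φ)
    {Cφ : ℝ} (hφI : PhiIntCond φ Cφ) :
    ∃ A q : ℝ, 1 ≤ A ∧ 0 < q ∧ q < 1 ∧ ∀ (x : X) (r : ℝ), 0 < r → ∀ k : ℕ,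
      φ x (2 ^ k * r) ≤ A * q ^ k * φ x r := by
  obtain ⟨C, hC, hD⟩ := hφD
  set A := 2 * C * max Cφ 1 with hA
  have hmx : 1 ≤ max Cφ 1 := le_max_right _ _
  have hA2 : 2 ≤ A := by nlinarith
  have hA0 : 0 < A := by linarith
  have hAi : A⁻¹ ≤ 1 / 2 := by
    rw [one_div]; exact inv_anti₀ (by norm_num) hA2
  have hAi0 : 0 < A⁻¹ := by positivity
  refine ⟨A, 1 - A⁻¹, by linarith, by linarith, by linarith, fun x r hr => ?_⟩
  have hstep : ∀ R : ℝ, 0 < R → φ x R ≤ 2 * C *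
      ((∫ t in Set.Ioi R, φ x t / t) - ∫ t in Set.Ioi (2 * R), φ x t / t) := by
    intro R hR
    have hi := (hφI x R hR).1
    have hun : Set.Ioi R = Set.Ioc R (2 * R) ∪ Set.Ioi (2 * R) :=
      (Set.Ioc_union_Ioi_eq_Ioi (by linarith)).symm
    have hi1 : IntegrableOn (fun t => φ x t / t) (Set.Ioc R (2 * R)) :=
      hi.mono_set Set.Ioc_subset_Ioi_self
    rw [hun, setIntegral_union Set.Ioc_disjoint_Ioi_same measurableSet_Ioi hi1
      (hi.mono_set (Set.Ioi_subset_Ioi (by linarith))), add_sub_cancel_right]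
    have hlow : ∫ t in Set.Ioc R (2 * R), φ x R / (2 * C * R)
        ≤ ∫ t in Set.Ioc R (2 * R), φ x t / t := by
      refine setIntegral_mono_on (integrableOn_const (by simp)) hi1 measurableSet_Ioc ?_
      intro t ht
      have ht0 : 0 < t := hR.trans ht.1
      have h1 := hD x R t hR ht0 (by linarith [ht.1]) ht.2
      have := hφpos x t ht0
      rw [div_le_div_iff₀ (by positivity) ht0]
      calc φ x R * t ≤ (C * φ x t) * (2 * R) := by
            gcongr
            exact ht.2
        _ = _ := by ring
    rw [setIntegral_const] at hlow
    simp only [smul_eq_mul, Measure.real, Real.volume_Ioc] at hlow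
    rw [ENNReal.toReal_ofReal (by linarith)] at hlow
    have h2 : (2 * R - R) * (φ x R / (2 * C * R)) = φ x R / (2 * C) := by
      field_simp; ring
    rw [h2, div_le_iff₀ (by positivity)] at hlow
    linarith
  have hI0 : ∀ R : ℝ, 0 < R → 0 ≤ ∫ t in Set.Ioi R, φ x t / t := fun R hR =>
    setIntegral_nonneg measurableSet_Ioi fun t ht =>
      div_nonneg (hφpos x t (hR.trans ht)).le (hR.trans ht).le
  have hIu : ∀ R : ℝ, 0 < R → (∫ t in Set.Ioi R, φ x t / t) ≤ max Cφ 1 * φ x R := by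
    intro R hR
    have := hφpos x R hR
    refine (hφI x R hR).2.trans ?_
    gcongr
    exact le_max_left _ _
  have hdec : ∀ k : ℕ, (∫ t in Set.Ioi (2 ^ k * r), φ x t / t)
      ≤ (1 - A⁻¹) ^ k * ∫ t in Set.Ioi r, φ x t / t := by
    intro k
    induction k with
    | zero => simp
    | succ k ih =>
      have hR : 0 < 2 ^ k * r := by positivity
      have h1 := hstep _ hR
      have h2 := hIu _ hR
      rw [show (2:ℝ) ^ (k+1) * r = 2 * (2 ^ k * r) by ring, pow_succ']
      set I := ∫ t in Set.Ioi (2 ^ k * r), φ x t / t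
      set J := ∫ t in Set.Ioi (2 * (2 ^ k * r)), φ x t / t
      have h3 : I ≤ A * (I - J) := by
        calc I ≤ _ := h2
          _ ≤ max Cφ 1 * (2 * C * (I - J)) := by gcongr
          _ = _ := by rw [hA]; ring
      have h4 : A⁻¹ * I ≤ I - J := by
        rw [inv_mul_le_iff₀ hA0]; exact h3
      have h5 : J ≤ (1 - A⁻¹) * I := by linarith
      rw [mul_assoc]
      refine h5.trans ?_
      have : 0 ≤ 1 - A⁻¹ := by linarith
      gcongr
  intro k
  have hR : 0 < 2 ^ k * r := by positivity
  have h1 := hstep _ hR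
  have h2 := hI0 (2 * (2 ^ k * r)) (by positivity)
  have h3 := hdec k
  have h4 := hIu r hr
  have : 0 ≤ 1 - A⁻¹ := by linarith
  calc _ ≤ _ := h1
    _ ≤ 2 * C * ((1 - A⁻¹) ^ k * (max Cφ 1 * φ x r)) := by
      gcongr
      refine le_trans (by linarith) (h3.trans ?_)
      gcongr
    _ = _ := by rw [hA]; ring

lemma exists_theta (l q : ℝ) (hl : 1 ≤ l) (hq : 0 < q) (hq1 : q < 1) :
    ∃ θ : ℝ, θ ∈ Set.Ioo (0:ℝ) 1 ∧ l ^ θ * q < 1 := by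
  have h : Tendsto (fun θ : ℝ => l ^ θ * q) (𝓝[>] 0) (𝓝 (l ^ (0:ℝ) * q)) := by
    refine Tendsto.mul_const q ?_
    exact (Real.continuous_const_rpow (by linarith)).continuousAt.tendsto.mono_left
      nhdsWithin_le_nhds
  have h1 := h.eventually_lt_const (show l ^ (0:ℝ) * q < 1 by simpa using hq1)
  have h2 : ∀ᶠ θ : ℝ in 𝓝[>] 0, θ ∈ Set.Ioo (0:ℝ) 1 := Ioo_mem_nhdsGT one_pos
  obtain ⟨θ, a, b⟩ := (h2.and h1).exists
  exact ⟨θ, a, b⟩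

lemma extO_mono {Φ : ℝ → ℝ} (hΦ : OrliczFun Φ) {s t : ℝ≥0∞} (h : s ≤ t) :
    extO Φ s ≤ extO Φ t := by
  unfold extO
  by_cases ht : t = ∞
  · simp [ht]
  have hs : s ≠ ∞ := ne_top_of_le_ne_top ht h
  rw [if_neg ht, if_neg hs]
  exact ENNReal.ofReal_le_ofReal (hΦ.mono _ _ ENNReal.toReal_nonneg
    (ENNReal.toReal_mono ht h))

lemma extO_scale {Φ : ℝ → ℝ} (hΦ : OrliczFun Φ) {r C₀ : ℝ} (hC₀ : 1 ≤ C₀)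
    (h : ∀ t s : ℝ, 0 < t → 0 < s → s < 1 → Φ (s * t) ≤ C₀ * s ^ r * Φ t)
    (s : ℝ) (hs : 0 < s) (hs1 : s < 1) (t : ℝ≥0∞) (ht : t ≠ ∞) :
    extO Φ (ENNReal.ofReal s * t) ≤ ENNReal.ofReal (C₀ * s ^ r) * extO Φ t := by
  unfold extO
  rw [if_neg ht, if_neg (ENNReal.mul_ne_top ENNReal.ofReal_ne_top ht),
    ← ENNReal.ofReal_mul (by positivity), ENNReal.toReal_mul, ENNReal.toReal_ofReal hs.le]
  apply ENNReal.ofReal_le_ofReal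
  rcases (ENNReal.toReal_nonneg (a := t)).eq_or_lt with h0 | h0
  · rw [← h0]; simp [hΦ.zero]
  · exact h _ _ h0 hs hs1

lemma weight_bound {M b t L P : ℝ≥0∞} (θ : ℝ) (h0 : 0 < θ) (h1 : θ < 1) (k : ℕ)
    (hb0 : b ≠ 0) (hb : b ≠ ∞) (ht0 : t ≠ 0) (ht : t ≠ ∞) (hP : 1 ≤ P)
    (hM : M * t ≤ P * b) (hk : t ≤ L ^ k * b) :
    M ^ (1 - θ) * t ≤ P * (L ^ θ) ^ k * b := by
  have e : ∀ a : ℝ≥0∞, a ≠ 0 → a ≠ ∞ → a = a ^ (1 - θ) * a ^ θ := fun a ha ha' => by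
    rw [← ENNReal.rpow_add _ _ ha ha']; simp
  calc M ^ (1 - θ) * t = (M * t) ^ (1 - θ) * t ^ θ := by
        rw [ENNReal.mul_rpow_of_nonneg _ _ (by linarith)]
        conv_lhs => rw [e t ht0 ht]
        ring
    _ ≤ (P * b) ^ (1 - θ) * (L ^ k * b) ^ θ := by
        gcongr
    _ = P ^ (1 - θ) * (L ^ θ) ^ k * (b ^ (1 - θ) * b ^ θ) := by
        rw [ENNReal.mul_rpow_of_nonneg _ _ (by linarith),
          ENNReal.mul_rpow_of_nonneg _ _ h0.le]
        rw [← ENNReal.rpow_natCast, ← ENNReal.rpow_natCast, ← ENNReal.rpow_mul,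
          ← ENNReal.rpow_mul, mul_comm (k:ℝ) θ]
        ring
    _ = P ^ (1 - θ) * (L ^ θ) ^ k * b := by rw [← e b hb0 hb]
    _ ≤ P ^ (1:ℝ) * (L ^ θ) ^ k * b := by
        gcongr
        linarith
    _ = _ := by simp

lemma key {ρ : X → X → ℝ} {μ : Measure X} {K₀ : ℝ} {L : ℝ≥0∞}
    (hX : IsQuasiMetricMeasure ρ μ K₀) (hL : IsDoubling ρ μ L) (m : ℕ)
    (hm : 9 * K₀ ^ 4 ≤ 2 ^ m) {φ : X → ℝ → ℝ} (hφpos : PhiPos φ)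
    {A q θ : ℝ} (hA : 1 ≤ A) (hq : 0 < q) (hq1 : q < 1) (h0 : 0 < θ) (h1 : θ < 1)
    (hdec : ∀ (x : X) (r : ℝ), 0 < r → ∀ k : ℕ, φ x (2 ^ k * r) ≤ A * q ^ k * φ x r)
    (F : X → ℝ≥0∞)
    (hF : ∀ (x : X) (r : ℝ), 0 < r →
      ∫⁻ y in ball ρ x r, F y ∂μ ≤ ENNReal.ofReal (φ x r) * μ (ball ρ x r))
    (x : X) (r : ℝ) (hr : 0 < r) :
    ∫⁻ y, F y * maximal ρ μ ((ball ρ x r).indicator fun _ => 1) y ^ (1 - θ) ∂μ ≤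
      (1 + L ^ (m + 1) * ENNReal.ofReal A * (1 - L ^ θ * ENNReal.ofReal q)⁻¹) *
        (ENNReal.ofReal (φ x r) * μ (ball ρ x r)) := by
  set w : X → ℝ≥0∞ := fun y => maximal ρ μ ((ball ρ x r).indicator fun _ => 1) y ^ (1 - θ)
    with hw
  set B : ℕ → Set X := fun k => ball ρ x (2 ^ k * r) with hB
  have hcov : (Set.univ : Set X) ⊆ ball ρ x r ∪ ⋃ k, (B (k + 1) \ B k) := by
    intro y _
    by_contra hy
    rw [Set.mem_union, not_or, Set.mem_iUnion, not_exists] at hy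
    have : ∀ k, y ∉ B k := by
      intro k
      induction k with
      | zero => simpa [hB] using hy.1
      | succ k ih => exact fun h => hy.2 k ⟨h, ih⟩
    obtain ⟨n, hn⟩ := pow_unbounded_of_one_lt (ρ x y / r) (one_lt_two)
    exact this n (by simpa [hB, ball] using (div_lt_iff₀ hr).1 hn)
  have hw1 : ∀ y, w y ≤ 1 := fun y =>
    ENNReal.rpow_le_one (maximal_le_one _ _ _ _) (by linarith)
  have hp0 : ∀ k : ℕ, 0 < 2 ^ k * r := fun k => by positivity
  have hann : ∀ k, ∫⁻ y in B (k + 1) \ B k, F y * w y ∂μ ≤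
      L ^ (m + 1) * ENNReal.ofReal A * (L ^ θ * ENNReal.ofReal q) ^ k *
        (ENNReal.ofReal (φ x r) * μ (ball ρ x r)) := by
    intro k
    have ht0 := (hL.2.2 x _ (hp0 k)).1.ne'
    have ht := (hL.2.2 x _ (hp0 k)).2.2.ne
    have hb0 := (hL.2.2 x _ hr).1.ne'
    have hb := (hL.2.2 x _ hr).2.2.ne
    set b := μ (ball ρ x r)
    set t := μ (B k) with htd
    have hLt : L ≠ ∞ := hL.2.1.ne
    set c : ℝ≥0∞ := L ^ m * (L ^ θ) ^ k * b / t with hc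
    have hct : c ≠ ∞ := by
      refine ENNReal.div_ne_top ?_ ht0
      refine ENNReal.mul_ne_top (ENNReal.mul_ne_top (ENNReal.pow_ne_top hLt)
        (ENNReal.pow_ne_top (ENNReal.rpow_ne_top_of_nonneg h0.le hLt))) hb
    have hwc : ∀ y ∈ B (k + 1) \ B k, w y ≤ c := by
      intro y hy
      rw [hc, ENNReal.le_div_iff_mul_le (Or.inl ht0) (Or.inl ht)]
      refine weight_bound θ h0 h1 k hb0 hb ht0 ht (one_le_pow₀ hL.1) ?_ ?_
      · refine maximal_decay hX hL m hm x r _ hr ?_ y hy.2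
        exact le_mul_of_one_le_left hr.le (one_le_pow₀ (by norm_num))
      · exact doubling_iter hL x r hr k
    have hφk : ENNReal.ofReal (φ x (2 ^ (k + 1) * r)) ≤
        ENNReal.ofReal A * ENNReal.ofReal q ^ k * ENNReal.ofReal (φ x r) := by
      rw [← ENNReal.ofReal_pow hq.le, ← ENNReal.ofReal_mul (by linarith),
        ← ENNReal.ofReal_mul (by positivity)]
      apply ENNReal.ofReal_le_ofReal
      refine (hdec x r hr (k + 1)).trans ?_
      have := hφpos x r hr
      gcongr A * ?_ * _
      exact pow_le_pow_of_le_one hq.le hq1.le (Nat.le_succ k)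
    have hdb : μ (B (k + 1)) ≤ L * t := by
      have := (hL.2.2 x _ (hp0 k)).2.1
      simp only [hB, htd]
      rwa [show (2:ℝ) ^ (k+1) * r = 2 * (2 ^ k * r) by ring]
    calc ∫⁻ y in B (k + 1) \ B k, F y * w y ∂μ
        ≤ ∫⁻ y in B (k + 1) \ B k, F y * c ∂μ :=
          setLIntegral_mono' ((hX.measurableSet_ball _ _).diff (hX.measurableSet_ball _ _))
            fun y hy => by gcongr; exact hwc y hy
      _ = (∫⁻ y in B (k + 1) \ B k, F y ∂μ) * c := lintegral_mul_const' _ _ hct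
      _ ≤ (∫⁻ y in B (k + 1), F y ∂μ) * c := by
          gcongr
          exact Set.diff_subset
      _ ≤ (ENNReal.ofReal (φ x (2 ^ (k + 1) * r)) * μ (B (k + 1))) * c := by
          gcongr
          exact hF x _ (hp0 (k + 1))
      _ ≤ (ENNReal.ofReal A * ENNReal.ofReal q ^ k * ENNReal.ofReal (φ x r) * (L * t)) * c := by
          gcongr
      _ = ENNReal.ofReal A * ENNReal.ofReal q ^ k * ENNReal.ofReal (φ x r) * L *
            (L ^ m * (L ^ θ) ^ k * b / t * t) := by rw [hc]; ring
      _ = _ := by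
          rw [ENNReal.div_mul_cancel ht0 ht, mul_pow]; ring
  calc ∫⁻ y, F y * w y ∂μ = ∫⁻ y in Set.univ, F y * w y ∂μ := by simp
    _ ≤ ∫⁻ y in ball ρ x r ∪ ⋃ k, (B (k + 1) \ B k), F y * w y ∂μ :=
        lintegral_mono_set hcov
    _ ≤ (∫⁻ y in ball ρ x r, F y * w y ∂μ) + ∫⁻ y in ⋃ k, (B (k + 1) \ B k), F y * w y ∂μ :=
        lintegral_union_le _ _ _
    _ ≤ (∫⁻ y in ball ρ x r, F y ∂μ) + ∑' k, ∫⁻ y in (B (k + 1) \ B k), F y * w y ∂μ := by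
        gcongr
        · exact mul_le_of_le_one_right' (hw1 _)
        · exact lintegral_iUnion_le _ _
    _ ≤ ENNReal.ofReal (φ x r) * μ (ball ρ x r) +
        ∑' k, L ^ (m + 1) * ENNReal.ofReal A * (L ^ θ * ENNReal.ofReal q) ^ k *
        (ENNReal.ofReal (φ x r) * μ (ball ρ x r)) :=
        add_le_add (hF x r hr) (ENNReal.tsum_le_tsum hann)
    _ = _ := by
        rw [ENNReal.tsum_mul_right, ENNReal.tsum_mul_left, ENNReal.tsum_geometric]
        ring

theorem statement18 [Nonempty X] (ρ : X → X → ℝ) (μ : Measure X) (K₀ : ℝ) (L : ℝ≥0∞)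
    (hX : IsQuasiMetricMeasure ρ μ K₀) (hL : IsDoubling ρ μ L)
    (φ : X → ℝ → ℝ) (hφpos : PhiPos φ) (hφD : PhiDoubling φ)
    (Cφ : ℝ) (hφI : PhiIntCond φ Cφ)
    (Φ : ℝ → ℝ) (hΦ : OrliczFun Φ) (hΦmono : StrictMonoOn Φ (Set.Ici (0:ℝ)))
    (rminus rplus : ℝ) (hrm : 0 < rminus) (hrp : 0 < rplus) (hrr : rminus ≤ rplus)
    (hlt : LowerType Φ rminus) (hut : UpperType Φ rplus) :
    ∃ θ : ℝ, θ ∈ Set.Ioo (0:ℝ) 1 ∧ ∃ C : ℝ, 1 ≤ C ∧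
      ∀ f : X → ℝ, Measurable f →
        OMnorm ρ μ Φ φ (fun x => ENNReal.ofReal |f x|) ≤
            (⨆ (x : X) (r : ℝ) (_ : 0 < r),
              wOrliczNorm Φ ((ENNReal.ofReal (φ x r) * μ (ball ρ x r))⁻¹ • μ)
                (fun y => maximal ρ μ ((ball ρ x r).indicator fun _ => 1) y ^ (1 - θ))
                (fun y => ENNReal.ofReal |f y|)) ∧
          (⨆ (x : X) (r : ℝ) (_ : 0 < r),
              wOrliczNorm Φ ((ENNReal.ofReal (φ x r) * μ (ball ρ x r))⁻¹ • μ)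
                (fun y => maximal ρ μ ((ball ρ x r).indicator fun _ => 1) y ^ (1 - θ))
                (fun y => ENNReal.ofReal |f y|)) ≤
            ENNReal.ofReal C * OMnorm ρ μ Φ φ (fun x => ENNReal.ofReal |f x|) := by
  obtain ⟨A, q, hA, hq, hq1, hdec⟩ := phi_decay hφpos hφD hφI
  have hLt : L ≠ ∞ := hL.2.1.ne
  have hl1 : 1 ≤ L.toReal := by
    simpa using ENNReal.toReal_mono hLt hL.1
  obtain ⟨θ, hθ, hθq⟩ := exists_theta L.toReal q hl1 hq hq1
  obtain ⟨m, hm⟩ := pow_unbounded_of_one_lt (9 * K₀ ^ 4) (one_lt_two)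
  have hq' : L ^ θ * ENNReal.ofReal q < 1 := by
    rw [← ENNReal.ofReal_toReal hLt, ENNReal.ofReal_rpow_of_pos (by linarith),
      ← ENNReal.ofReal_mul (by positivity)]
    exact ENNReal.ofReal_lt_one.2 hθq
  set D : ℝ≥0∞ := 1 + L ^ (m + 1) * ENNReal.ofReal A * (1 - L ^ θ * ENNReal.ofReal q)⁻¹ with hD
  have hDt : D ≠ ∞ := by
    refine ENNReal.add_ne_top.2 ⟨by simp, ENNReal.mul_ne_top (ENNReal.mul_ne_top
      (ENNReal.pow_ne_top hLt) ENNReal.ofReal_ne_top) ?_⟩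
    exact ENNReal.inv_ne_top.2 (tsub_pos_of_lt hq').ne'
  obtain ⟨C₀, hC₀, hlow⟩ := hlt
  have hex : ∃ s : ℝ, s ∈ Set.Ioo (0:ℝ) 1 ∧ C₀ * s ^ rminus * D.toReal < 1 := by
    have h : Tendsto (fun s : ℝ => C₀ * s ^ rminus * D.toReal) (𝓝[>] 0)
        (𝓝 (C₀ * 0 ^ rminus * D.toReal)) := by
      refine Tendsto.mul_const _ (Tendsto.const_mul _ ?_)
      exact (Real.continuousAt_rpow_const 0 rminus (Or.inr hrm.le)).tendsto.mono_left
        nhdsWithin_le_nhds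
    have h1 := h.eventually_lt_const (u := 1) (by simp [Real.zero_rpow hrm.ne'])
    have h2 : ∀ᶠ θ : ℝ in 𝓝[>] 0, θ ∈ Set.Ioo (0:ℝ) 1 := Ioo_mem_nhdsGT one_pos
    exact (h2.and h1).exists
  obtain ⟨s, ⟨hs0, hs1⟩, hsD⟩ := hex
  have hsD' : ENNReal.ofReal (C₀ * s ^ rminus) * D ≤ 1 := by
    rw [← ENNReal.ofReal_toReal hDt, ← ENNReal.ofReal_mul (by positivity)]
    exact ENNReal.ofReal_le_one.2 hsD.le
  have hN : ∀ (x : X) (r : ℝ), 0 < r → ENNReal.ofReal (φ x r) * μ (ball ρ x r) ≠ 0 ∧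
      ENNReal.ofReal (φ x r) * μ (ball ρ x r) ≠ ∞ := fun x r hr =>
    ⟨mul_ne_zero (ENNReal.ofReal_pos.2 (hφpos x r hr)).ne' (hL.2.2 x r hr).1.ne',
      ENNReal.mul_ne_top ENNReal.ofReal_ne_top (hL.2.2 x r hr).2.2.ne⟩
  have hiff : ∀ (x : X) (r : ℝ), 0 < r → ∀ G : X → ℝ≥0∞,
      (∫⁻ y, G y ∂((ENNReal.ofReal (φ x r) * μ (ball ρ x r))⁻¹ • μ) ≤ 1 ↔
        ∫⁻ y, G y ∂μ ≤ ENNReal.ofReal (φ x r) * μ (ball ρ x r)) := by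
    intro x r hr G
    rw [lintegral_smul_measure, smul_eq_mul, mul_comm, ← div_eq_mul_inv,
      ENNReal.div_le_iff (hN x r hr).1 (hN x r hr).2, one_mul]
  refine ⟨θ, hθ, s⁻¹, (one_le_inv₀ hs0).2 hs1.le, fun f _ => ⟨?_, ?_⟩⟩
  · refine iSup_mono fun x => iSup_mono fun r => iSup_mono fun hr => ?_
    refine sInf_le_sInf ?_
    rintro lam ⟨hl0, hl⟩
    refine ⟨hl0, ?_⟩
    rw [hiff x r hr] at hl
    refine le_trans ?_ hl
    refine le_trans ?_ (setLIntegral_le_lintegral (ball ρ x r) _)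
    refine setLIntegral_mono' (hX.measurableSet_ball _ _) fun y hy => ?_
    refine le_mul_of_one_le_right' ?_
    refine ENNReal.one_le_rpow (one_le_maximal ρ μ x r hr (hX.measurableSet_ball _ _)
      (hL.2.2 x r hr).1.ne' (hL.2.2 x r hr).2.2.ne y hy) (by linarith [hθ.2])
  · refine iSup_le fun x => iSup_le fun r => iSup_le fun hr => ?_
    have hs' : ENNReal.ofReal s⁻¹ = (ENNReal.ofReal s)⁻¹ := ENNReal.ofReal_inv_of_pos hs0
    have hsE0 : ENNReal.ofReal s ≠ 0 := (ENNReal.ofReal_pos.2 hs0).ne'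
    rw [hs', mul_comm _ (OMnorm _ _ _ _ _), ← div_eq_mul_inv,
      ENNReal.le_div_iff_mul_le (Or.inl hsE0) (Or.inl ENNReal.ofReal_ne_top)]
    refine le_of_forall_gt_imp_ge_of_dense fun lam hlam => ?_
    by_cases hlt : lam = ∞
    · simp [hlt]
    have hl0 : lam ≠ 0 := (bot_lt_of_lt hlam).ne'
    rw [← ENNReal.le_div_iff_mul_le (Or.inl hsE0) (Or.inl ENNReal.ofReal_ne_top)]
    have hF : ∀ (x : X) (r : ℝ), 0 < r →
        ∫⁻ y in ball ρ x r, extO Φ (ENNReal.ofReal |f y| / lam) ∂μ ≤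
          ENNReal.ofReal (φ x r) * μ (ball ρ x r) := by
      intro x r hr
      have h1 : ballNorm ρ μ Φ φ x r (fun x => ENNReal.ofReal |f x|) < lam := by
        refine lt_of_le_of_lt ?_ hlam
        unfold OMnorm
        refine le_iSup_of_le x ?_
        refine le_iSup_of_le r ?_
        refine le_iSup_of_le hr ?_
        exact le_refl _
      obtain ⟨l', ⟨hl'0, hl'⟩, hll⟩ := sInf_lt_iff.1 h1
      refine le_trans (lintegral_mono fun y => extO_mono hΦ ?_) hl'
      gcongr
    have hk := key hX hL m hm.le hφpos hA hq hq1 hθ.1 hθ.2 hdec _ hF x r hr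
    refine sInf_le ⟨?_, ?_⟩
    · exact (ENNReal.div_pos hl0 ENNReal.ofReal_ne_top).ne'
    rw [hiff x r hr]
    have hpt : ∀ y, extO Φ (ENNReal.ofReal |f y| / (lam / ENNReal.ofReal s)) ≤
        ENNReal.ofReal (C₀ * s ^ rminus) * extO Φ (ENNReal.ofReal |f y| / lam) := by
      intro y
      have : ENNReal.ofReal |f y| / (lam / ENNReal.ofReal s) =
          ENNReal.ofReal s * (ENNReal.ofReal |f y| / lam) := by
        rw [div_eq_mul_inv, ENNReal.inv_div (Or.inl ENNReal.ofReal_ne_top) (Or.inl hsE0),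
          div_eq_mul_inv, div_eq_mul_inv]
        ring
      rw [this]
      exact extO_scale hΦ hC₀ hlow s hs0 hs1 _ (ENNReal.div_ne_top ENNReal.ofReal_ne_top hl0)
    calc _ ≤ ∫⁻ y, ENNReal.ofReal (C₀ * s ^ rminus) * (extO Φ (ENNReal.ofReal |f y| / lam) *
            maximal ρ μ ((ball ρ x r).indicator fun _ => 1) y ^ (1 - θ)) ∂μ := by
          refine lintegral_mono fun y => ?_
          rw [← mul_assoc]
          gcongr
          exact hpt y
      _ = ENNReal.ofReal (C₀ * s ^ rminus) * ∫⁻ y, extO Φ (ENNReal.ofReal |f y| / lam) *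
            maximal ρ μ ((ball ρ x r).indicator fun _ => 1) y ^ (1 - θ) ∂μ :=
          lintegral_const_mul' _ _ ENNReal.ofReal_ne_top
      _ ≤ ENNReal.ofReal (C₀ * s ^ rminus) * (D * (ENNReal.ofReal (φ x r) * μ (ball ρ x r))) := by
          gcongr
      _ = ENNReal.ofReal (C₀ * s ^ rminus) * D * (ENNReal.ofReal (φ x r) * μ (ball ρ x r)) := by
          ring
      _ ≤ 1 * (ENNReal.ofReal (φ x r) * μ (ball ρ x r)) := by gcongr
      _ = _ := one_mul _
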